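/- arXiv:1210.6970 — 2 statements merged into one kernel-verified Lean document; each statement's English description precedes it below -/
import Mathlib

section
/- Let A be an m×n real matrix with nonnegative entries and let D₁ (m×m) and D₂ (n×n) be diagonal matrices with strictly positive diagonal entries. Set Ã = D₁AD₂, P = D₁⁻² and Q = D₂⁻². Then ν₊(Ã;P,Q)² / trace(ÃᵀPÃQ) = ν₊(A)² / ‖A‖_F². -/
open Matrix BigOperators

/-- A symmetric matrix `M` is copositive if `xᵀ M x ≥ 0` for every entrywise
nonnegative vector `x`. -/
def Copositive {k : Type*} [Fintype k] (M : Matrix k k ℝ) : Prop :=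
  ∀ x : k → ℝ, (∀ i, 0 ≤ x i) → 0 ≤ x ⬝ᵥ M.mulVec x

/-- `ν₊(A; P, Q)`: the supremum of `⟨A, W⟩ = trace(Aᵀ W)` over all `W` such that
the block matrix `[[P, −W], [−Wᵀ, Q]]` is copositive. -/
noncomputable def nuPlusPQ {m n : ℕ} (A : Matrix (Fin m) (Fin n) ℝ)
    (P : Matrix (Fin m) (Fin m) ℝ) (Q : Matrix (Fin n) (Fin n) ℝ) : ℝ :=
  sSup {t : ℝ | ∃ W : Matrix (Fin m) (Fin n) ℝ,
    Copositive (Matrix.fromBlocks P (-W) (-Wᵀ) Q) ∧ t = Matrix.trace (Aᵀ * W)}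

/-- `ν₊(A) = ν₊(A; I, I)`. -/
noncomputable def nuPlus {m n : ℕ} (A : Matrix (Fin m) (Fin n) ℝ) : ℝ :=
  nuPlusPQ A 1 1

theorem copositive_diag_scale {k : Type*} [Fintype k] [DecidableEq k] {M : Matrix k k ℝ}
    (hM : Copositive M) (s : k → ℝ) (hs : ∀ i, 0 ≤ s i) :
    Copositive (Matrix.of fun i j => s i * M i j * s j) := by
  intro x hx
  have h := hM (fun i => s i * x i) (fun i => mul_nonneg (hs i) (hx i))
  convert h using 1
  simp only [dotProduct, Matrix.mulVec, Matrix.of_apply, Finset.mul_sum]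
  refine Finset.sum_congr rfl fun i _ => Finset.sum_congr rfl fun j _ => ?_
  ring

theorem trace_transpose_mul_eq_sum {m n : ℕ} (A W : Matrix (Fin m) (Fin n) ℝ) :
    Matrix.trace (Aᵀ * W) = ∑ j, ∑ i, A i j * W i j := by
  simp [Matrix.trace, Matrix.mul_apply]

theorem nuPlusPQ_scale {m n : ℕ} (A : Matrix (Fin m) (Fin n) ℝ)
    (d₁ : Fin m → ℝ) (d₂ : Fin n → ℝ)
    (hd₁ : ∀ i, 0 < d₁ i) (hd₂ : ∀ j, 0 < d₂ j) :
    nuPlusPQ (Matrix.diagonal d₁ * A * Matrix.diagonal d₂)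
        (Matrix.diagonal fun i => (d₁ i ^ 2)⁻¹)
        (Matrix.diagonal fun j => (d₂ j ^ 2)⁻¹) = nuPlus A := by
  have h1 : ∀ i, d₁ i ≠ 0 := fun i => (hd₁ i).ne'
  have h2 : ∀ i, d₂ i ≠ 0 := fun i => (hd₂ i).ne'
  unfold nuPlus nuPlusPQ
  congr 1
  ext t
  constructor
  · rintro ⟨W, hW, rfl⟩
    refine ⟨Matrix.of fun i j => d₁ i * W i j * d₂ j, ?_, ?_⟩
    · have h := copositive_diag_scale hW (Sum.elim d₁ d₂)
        (by rintro (i | i); exacts [(hd₁ i).le, (hd₂ i).le])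
      convert h using 1
      ext (i | i) (j | j)
      · by_cases hij : i = j
        · subst hij
          have := h1 i
          simp; field_simp
        · simp [hij]
      · simp
      · simp; ring
      · by_cases hij : i = j
        · subst hij
          have := h2 i
          simp; field_simp
        · simp [hij]
    · rw [trace_transpose_mul_eq_sum, trace_transpose_mul_eq_sum]
      refine Finset.sum_congr rfl fun j _ => Finset.sum_congr rfl fun i _ => ?_
      simp only [Matrix.mul_diagonal, Matrix.diagonal_mul, Matrix.of_apply]
      ring
  · rintro ⟨W, hW, rfl⟩
    refine ⟨Matrix.of fun i j => (d₁ i)⁻¹ * W i j * (d₂ j)⁻¹, ?_, ?_⟩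
    · have h := copositive_diag_scale hW (Sum.elim (fun i => (d₁ i)⁻¹) (fun j => (d₂ j)⁻¹))
        (by rintro (i | i); exacts [(inv_pos.2 (hd₁ i)).le, (inv_pos.2 (hd₂ i)).le])
      convert h using 1
      ext (i | i) (j | j)
      · by_cases hij : i = j
        · subst hij
          have := h1 i
          simp; field_simp
        · simp [hij]
      · simp
      · simp; ring
      · by_cases hij : i = j
        · subst hij
          have := h2 i
          simp; field_simp
        · simp [hij]
    · rw [trace_transpose_mul_eq_sum, trace_transpose_mul_eq_sum]
      refine Finset.sum_congr rfl fun j _ => Finset.sum_congr rfl fun i _ => ?_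
      simp only [Matrix.mul_diagonal, Matrix.diagonal_mul, Matrix.of_apply]
      have := h1 i
      have := h2 j
      field_simp

/-- Invariance under diagonal scaling: for `Ã = D₁ A D₂`, `P = D₁⁻²`, `Q = D₂⁻²`,
we have `ν₊(Ã;P,Q)² / trace(Ãᵀ P Ã Q) = ν₊(A)² / ‖A‖_F²`. -/
theorem nuPlus_diagonal_scaling_invariance {m n : ℕ}
    (A : Matrix (Fin m) (Fin n) ℝ) (hA : ∀ i j, 0 ≤ A i j)
    (d₁ : Fin m → ℝ) (d₂ : Fin n → ℝ)
    (hd₁ : ∀ i, 0 < d₁ i) (hd₂ : ∀ j, 0 < d₂ j) :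
    (nuPlusPQ (Matrix.diagonal d₁ * A * Matrix.diagonal d₂)
        (Matrix.diagonal fun i => (d₁ i ^ 2)⁻¹)
        (Matrix.diagonal fun j => (d₂ j ^ 2)⁻¹)) ^ 2 /
      Matrix.trace ((Matrix.diagonal d₁ * A * Matrix.diagonal d₂)ᵀ *
        (Matrix.diagonal fun i => (d₁ i ^ 2)⁻¹) *
        (Matrix.diagonal d₁ * A * Matrix.diagonal d₂) *
        (Matrix.diagonal fun j => (d₂ j ^ 2)⁻¹)) =
    (nuPlus A) ^ 2 / (∑ i, ∑ j, (A i j) ^ 2) := by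
  rw [nuPlusPQ_scale A d₁ d₂ hd₁ hd₂]
  congr 1
  rw [Matrix.mul_assoc, Matrix.mul_assoc, trace_transpose_mul_eq_sum, Finset.sum_comm]
  refine Finset.sum_congr rfl fun i _ => Finset.sum_congr rfl fun j _ => ?_
  simp only [Matrix.mul_diagonal, Matrix.diagonal_mul]
  have := (hd₁ i).ne'
  have := (hd₂ j).ne'
  field_simp
end

section
/- Let n ≥ 1 and let S(Cₙ) be the slack matrix of the hypercube [0,1]ⁿ: the 2n × 2ⁿ matrix with rows indexed by pairs (k, ε) with k ∈ {1,…,n} and ε ∈ {0,1}, columns indexed by binary words v ∈ {0,1}ⁿ, whose entry at ((k,0), v) is vₖ and at ((k,1), v) is 1 − vₖ. Then rank₊(S(Cₙ)) = 2n. -/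
open Matrix BigOperators

/-- The nonnegative rank: the smallest `r` such that `A = U * V` with `U, V`
entrywise nonnegative. -/
noncomputable def rankPlus {F V : Type*} [Fintype F] [Fintype V]
    (A : Matrix F V ℝ) : ℕ :=
  sInf {r : ℕ | ∃ U : Matrix F (Fin r) ℝ, ∃ Vm : Matrix (Fin r) V ℝ,
    (∀ i j, 0 ≤ U i j) ∧ (∀ i j, 0 ≤ Vm i j) ∧ A = U * Vm}

/-- The slack matrix of the hypercube `[0,1]ⁿ`: rows are indexed by facets
`(k, ε)` (the facet `xₖ = ε`), columns by vertices `v ∈ {0,1}ⁿ`; the entry at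
`((k, 0), v)` is `vₖ` and at `((k, 1), v)` is `1 − vₖ`. -/
def slackHypercube (n : ℕ) : Matrix (Fin n × Bool) (Fin n → Bool) ℝ :=
  Matrix.of fun fe v =>
    if fe.2 then 1 - (if v fe.1 then 1 else 0) else (if v fe.1 then 1 else 0)

/-- Rectangle-covering bound for the cube, relativized to a set `S` of free coordinates. -/
theorem cover_bound {κ ι : Type*} [DecidableEq κ] [DecidableEq ι]
    (R : ι → κ → Bool → Prop) (S : Finset κ) :
    ∀ (I : Finset ι) (w : κ → Bool),
      (∀ v : κ → Bool, (∀ j, j ∉ S → v j = w j) → ∀ k ∈ S,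
        ∃ i ∈ I, R i k (v k) ∧ ∀ j b, R i j b → v j = b) →
      2 * S.card ≤ I.card := by
  classical
  induction S using Finset.induction_on with
  | empty => intro I w _; simp
  | insert k S hk ih =>
    intro I w h
    rw [Finset.card_insert_of_notMem hk]
    by_cases hbig : ∃ b, 2 ≤ (I.filter (fun i => R i k b)).card
    · obtain ⟨b, hb⟩ := hbig
      have h1 := ih (I.filter (fun i => ¬ R i k b)) (Function.update w k (!b)) (by
        intro v hv j hj
        have hvk : v k = !b := by simpa using hv k hk
        obtain ⟨i, hi, hr, hc⟩ := h v (by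
          intro l hl
          rw [Finset.mem_insert, not_or] at hl
          rw [hv l hl.2, Function.update_of_ne hl.1]) j (Finset.mem_insert_of_mem hj)
        refine ⟨i, ?_, hr, hc⟩
        rw [Finset.mem_filter]
        refine ⟨hi, fun hR => ?_⟩
        have := hc k b hR
        rw [hvk] at this
        cases b <;> simp at this)
      have h2 := Finset.card_filter_add_card_filter_not (s := I) (fun i => R i k b)
      omega
    · push Not at hbig
      have hex : ∀ b, ∃ i ∈ I, R i k b ∧ ¬ R i k (!b) ∧ ∀ j ∈ S, ∀ c, ¬ R i j c := by
        intro b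
        have key : ∀ v : κ → Bool, (∀ j, j ∉ insert k S → v j = w j) → v k = b →
            ∃ i ∈ I, R i k b ∧ ∀ j c, R i j c → v j = c := by
          intro v hv hvk
          have := h v hv k (Finset.mem_insert_self _ _)
          rwa [hvk] at this
        obtain ⟨i, hi, hr, hc⟩ := key (Function.update w k b) (by
          intro j hj
          rw [Finset.mem_insert, not_or] at hj
          rw [Function.update_of_ne hj.1]) (by simp)
        refine ⟨i, hi, hr, ?_, ?_⟩
        · intro hR
          have := hc _ _ hR
          cases b <;> simp at this
        · intro j hj c hR
          have hjk : j ≠ k := fun e => hk (e ▸ hj)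
          obtain ⟨i', hi', hr', hc'⟩ := key
            (Function.update (Function.update w k b) j (!c)) (by
              intro l hl
              rw [Finset.mem_insert, not_or] at hl
              have : l ≠ j := fun e => hl.2 (e ▸ hj)
              rw [Function.update_of_ne this, Function.update_of_ne hl.1])
            (by rw [Function.update_of_ne hjk.symm]; simp)
          have hii : i = i' := by
            have hle : (I.filter (fun i => R i k b)).card ≤ 1 := by
              have := hbig b
              omega
            exact Finset.card_le_one.mp hle i (by simp [hi, hr]) i' (by simp [hi', hr'])
          subst hii
          have := hc' j c hR
          cases c <;> simp at this
      obtain ⟨i0, hi0, hr0, hn0, hS0⟩ := hex false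
      obtain ⟨i1, hi1, hr1, hn1, hS1⟩ := hex true
      have hne : i0 ≠ i1 := by
        rintro rfl
        exact hn0 hr1
      have h1 := ih ((I.erase i0).erase i1) w (by
        intro v hv j hj
        obtain ⟨i, hi, hr, hc⟩ := h v (fun l hl =>
          hv l (fun h' => hl (Finset.mem_insert_of_mem h'))) j (Finset.mem_insert_of_mem hj)
        refine ⟨i, ?_, hr, hc⟩
        rw [Finset.mem_erase, Finset.mem_erase]
        refine ⟨?_, ?_, hi⟩
        · rintro rfl
          exact hS1 j hj _ hr
        · rintro rfl
          exact hS0 j hj _ hr)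
      have h2 : i1 ∈ I.erase i0 := Finset.mem_erase.mpr ⟨hne.symm, hi1⟩
      have h3 := Finset.card_erase_add_one h2
      have h4 := Finset.card_erase_add_one hi0
      omega

theorem slack_nonneg (n : ℕ) (f : Fin n × Bool) (v : Fin n → Bool) :
    0 ≤ slackHypercube n f v := by
  obtain ⟨k, b⟩ := f
  cases b <;> cases hv : v k <;> simp [slackHypercube, hv]

theorem slack_pos_iff (n : ℕ) (k : Fin n) (b : Bool) (v : Fin n → Bool) :
    0 < slackHypercube n (k, !b) v ↔ v k = b := by
  cases b <;> cases hv : v k <;> simp [slackHypercube, hv]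

/-- The nonnegative rank of the slack matrix of the hypercube `[0,1]ⁿ` is `2n`. -/
theorem rankPlus_slackHypercube (n : ℕ) (hn : 1 ≤ n) :
    rankPlus (slackHypercube n) = 2 * n := by
  unfold rankPlus
  apply le_antisymm
  · apply Nat.sInf_le
    let e : Fin n × Bool ≃ Fin (2 * n) :=
      Fintype.equivFinOfCardEq (by simp [mul_comm])
    refine ⟨(1 : Matrix (Fin n × Bool) (Fin n × Bool) ℝ).submatrix id e.symm,
      (slackHypercube n).submatrix e.symm id, ?_, ?_, ?_⟩
    · intro i j
      simp only [Matrix.submatrix_apply, Matrix.one_apply]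
      split_ifs <;> norm_num
    · intro i j
      exact slack_nonneg n _ _
    · rw [Matrix.submatrix_mul_equiv, Matrix.one_mul, Matrix.submatrix_id_id]
  · apply le_csInf
    · refine ⟨2 * n, ?_⟩
      let e : Fin n × Bool ≃ Fin (2 * n) :=
        Fintype.equivFinOfCardEq (by simp [mul_comm])
      refine ⟨(1 : Matrix (Fin n × Bool) (Fin n × Bool) ℝ).submatrix id e.symm,
        (slackHypercube n).submatrix e.symm id, ?_, ?_, ?_⟩
      · intro i j
        simp only [Matrix.submatrix_apply, Matrix.one_apply]
        split_ifs <;> norm_num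
      · intro i j
        exact slack_nonneg n _ _
      · rw [Matrix.submatrix_mul_equiv, Matrix.one_mul, Matrix.submatrix_id_id]
    · rintro r ⟨U, V, hU, hV, hA⟩
      have := cover_bound (fun (i : Fin r) (k : Fin n) (b : Bool) => 0 < U (k, !b) i)
        Finset.univ Finset.univ (fun _ => false) (by
          intro v _ k _
          have hp : 0 < slackHypercube n (k, !(v k)) v := (slack_pos_iff n k _ v).2 rfl
          rw [hA, Matrix.mul_apply] at hp
          obtain ⟨i, _, hi⟩ := Finset.exists_lt_of_sum_lt
            (s := Finset.univ) (f := fun _ : Fin r => (0 : ℝ)) (by simpa using hp)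
          have hUi : 0 < U (k, !(v k)) i := pos_of_mul_pos_left hi (hV _ _)
          have hVi : 0 < V i v := pos_of_mul_pos_right hi (hU _ _)
          refine ⟨i, Finset.mem_univ _, hUi, ?_⟩
          intro j b hR
          rw [← slack_pos_iff, hA, Matrix.mul_apply]
          exact lt_of_lt_of_le (mul_pos hR hVi)
            (Finset.single_le_sum (f := fun i => U (j, !b) i * V i v)
              (fun l _ => mul_nonneg (hU _ _) (hV _ _)) (Finset.mem_univ i)))
      simpa using this
end
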